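/- Let X be a topological space with a family B of subsets, and let f : ω → [2, ℵ₀) be a bounded function with k = limsup_n f(n). Then Player II has a winning strategy in the game G_f(O_B, O_B) if and only if Player II has a winning strategy in G_k(O_B, O_B), assuming also that Player I has no winning strategy is preserved (so the games are equivalent). -/

import Mathlib

/-- `𝒰` is a `𝓑`-covering of `X`: a family of open sets such that every member of `𝓑`
is contained in some member of `𝒰`. -/
def IsBCover {X : Type*} [TopologicalSpace X] (𝓑 𝒰 : Set (Set X)) : Prop :=
  (∀ U ∈ 𝒰, IsOpen U) ∧ ∀ B ∈ 𝓑, ∃ U ∈ 𝒰, B ⊆ U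

/-- The upper semi-finite topology on the family `𝓑`, generated by the sets
`⟨U⟩ = {B ∈ 𝓑 : B ⊆ U}` for `U` open in `X`. -/
def upperTop {X : Type*} [TopologicalSpace X] (𝓑 : Set (Set X)) : TopologicalSpace ↥𝓑 :=
  TopologicalSpace.generateFrom {S | ∃ U : Set X, IsOpen U ∧ S = {b : ↥𝓑 | ↑b ⊆ U}}

/-- `σ` is a winning strategy for Player II in the game `G_φ(O_𝓑, O_𝓑)`: in inning `n`
Player I chooses a `𝓑`-covering `A n` and Player II (following `σ`, applied to the
history of Player I's moves) selects a subfamily of size `< φ n`; Player II wins a play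
if the union of the selections is a `𝓑`-covering. -/
def IIWinning {X : Type*} [TopologicalSpace X] (𝓑 : Set (Set X)) (φ : ℕ → ℕ)
    (σ : List (Set (Set X)) → Set (Set X)) : Prop :=
  ∀ A : ℕ → Set (Set X), (∀ n, IsBCover 𝓑 (A n)) →
    (∀ n, σ (List.ofFn fun i : Fin (n + 1) => A i) ⊆ A n ∧
        (σ (List.ofFn fun i : Fin (n + 1) => A i)).Finite ∧
        (σ (List.ofFn fun i : Fin (n + 1) => A i)).ncard < φ n) ∧
      IsBCover 𝓑 (⋃ n, σ (List.ofFn fun i : Fin (n + 1) => A i))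

/-- `τ` is a winning strategy for Player I in the game `G_φ(O_𝓑, O_𝓑)`: `τ` always
plays `𝓑`-coverings (as a function of the history of Player II's moves), and for every
sequence of legal responses of Player II, the union of the selections is not a
`𝓑`-covering. -/
def IWinning {X : Type*} [TopologicalSpace X] (𝓑 : Set (Set X)) (φ : ℕ → ℕ)
    (τ : List (Set (Set X)) → Set (Set X)) : Prop :=
  (∀ l, IsBCover 𝓑 (τ l)) ∧
    ∀ C : ℕ → Set (Set X),
      (∀ n, C n ⊆ τ (List.ofFn fun i : Fin n => C i) ∧ (C n).Finite ∧
        (C n).ncard < φ n) →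
      ¬ IsBCover 𝓑 (⋃ n, C n)

/-- countable-subcover property -/
def LindB {X : Type*} [TopologicalSpace X] (𝓑 : Set (Set X)) : Prop :=
  ∀ 𝒰, IsBCover 𝓑 𝒰 → ∃ U : ℕ → Set X, (∀ n, U n ∈ 𝒰) ∧ ∀ B ∈ 𝓑, ∃ n, B ⊆ U n

/-- `u` is a legal list of single selections against `τ`. -/
def RunB {X : Type*} : (List (Set X) → Set (Set X)) → List (Set X) → Prop
  | _, [] => True
  | τ, a :: u => a ∈ τ [] ∧ RunB (fun l => τ (a :: l)) u

open Classical in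
theorem key_lemma {X : Type*} [TopologicalSpace X] {𝓑 : Set (Set X)} (L : LindB 𝓑) (k : ℕ) :
    ∀ τ : List (Set X) → Set (Set X), (∀ l, IsBCover 𝓑 (τ l)) →
      ∃ 𝒱, IsBCover 𝓑 𝒱 ∧ ∀ D : Finset (Set X), (D : Set (Set X)) ⊆ 𝒱 → D.card ≤ k →
        ∃ u, u.length = k ∧ RunB τ u ∧ ∀ V ∈ D, ∃ W ∈ u, V ⊆ W := by
  induction k with
  | zero =>
    intro τ hτ
    refine ⟨τ [], hτ _, fun D _ hc => ⟨[], rfl, trivial, ?_⟩⟩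
    have : D = ∅ := by simpa using hc
    simp [this]
  | succ k ih =>
    intro τ hτ
    obtain ⟨U, hU, hUc⟩ := L _ (hτ [])
    choose 𝒲 hW hWD using fun n => ih (fun l => τ (U n :: l)) (fun l => hτ _)
    refine ⟨{V | ∃ n, ∃ v : ℕ → Set X, (∀ i, v i ∈ 𝒲 i) ∧ V = U n ∩ ⋂ i ∈ Finset.range (n+1), v i},
      ⟨?_, ?_⟩, ?_⟩
    · rintro V ⟨n, v, hv, rfl⟩
      refine ((hτ []).1 _ (hU n)).inter ?_
      exact isOpen_biInter_finset fun i _ => (hW i).1 _ (hv i)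
    · intro B hB
      obtain ⟨n, hn⟩ := hUc B hB
      choose v hv hBv using fun i => (hW i).2 B hB
      exact ⟨_, ⟨n, v, hv, rfl⟩, Set.subset_inter hn (Set.subset_iInter₂ fun i _ => hBv i)⟩
    · intro D hD hc
      rcases D.eq_empty_or_nonempty with rfl | hDne
      · obtain ⟨u, h1, h2, -⟩ := hWD 0 ∅ (by simp) (by simp)
        exact ⟨U 0 :: u, by simp [h1], ⟨hU 0, h2⟩, by simp⟩
      · have hD' : ∀ V : Set X, ∃ n, ∃ v : ℕ → Set X, V ∈ D → (∀ i, v i ∈ 𝒲 i) ∧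
            V = U n ∩ ⋂ i ∈ Finset.range (n+1), v i := by
          intro V
          by_cases h : V ∈ D
          · obtain ⟨n, v, h1, h2⟩ := hD h
            exact ⟨n, v, fun _ => ⟨h1, h2⟩⟩
          · exact ⟨0, fun _ => ∅, fun h' => absurd h' h⟩
        choose N v hv using hD'
        obtain ⟨V₀, hV₀, hmin⟩ := D.exists_min_image N hDne
        obtain ⟨u, h1, h2, h3⟩ := hWD (N V₀) ((D.erase V₀).image fun V => v V (N V₀)) (by
            intro W hW'
            simp only [Finset.coe_image, Set.mem_image, Finset.mem_coe, Finset.mem_erase] at hW'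
            obtain ⟨V, ⟨_, hV⟩, rfl⟩ := hW'
            exact (hv V hV).1 _) (by
            refine Finset.card_image_le.trans ?_
            rw [Finset.card_erase_of_mem hV₀]; omega)
        refine ⟨U (N V₀) :: u, by simp [h1], ⟨hU _, h2⟩, ?_⟩
        intro V hV
        by_cases h : V = V₀
        · refine ⟨U (N V₀), by simp, ?_⟩
          rw [h]
          conv_lhs => rw [(hv V₀ hV₀).2]
          exact Set.inter_subset_left
        · obtain ⟨W, hWu, hVW⟩ := h3 (v V (N V₀)) (Finset.mem_image_of_mem _
            (Finset.mem_erase.2 ⟨h, hV⟩))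
          refine ⟨W, by simp [hWu], Set.Subset.trans ?_ hVW⟩
          conv_lhs => rw [(hv V hV).2]
          refine Set.inter_subset_right.trans (Set.biInter_subset_of_mem ?_)
          have := hmin V hV
          simp; omega

theorem RunB_append {X : Type*} (u v : List (Set X)) : ∀ (τ : List (Set X) → Set (Set X)),
    RunB τ u → RunB (fun l => τ (u ++ l)) v → RunB τ (u ++ v) := by
  induction u with
  | nil => intro τ _ h; simpa using h
  | cons a u ih =>
    intro τ h h'
    exact ⟨h.1, ih _ h.2 h'⟩

theorem RunB_get {X : Type*} (u : List (Set X)) : ∀ (τ : List (Set X) → Set (Set X)),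
    RunB τ u → ∀ i (h : i < u.length), u[i] ∈ τ (u.take i) := by
  induction u with
  | nil => intro τ _ i h; simp at h
  | cons a u ih =>
    intro τ h i hi
    cases i with
    | zero => simpa using h.1
    | succ i => simpa using ih _ h.2 i (by simpa using hi)

/-- A growing sequence of lists has a limit. -/
theorem list_limit {α : Type*} [Inhabited α] (p : ℕ → List α) (hp : ∀ m, p m <+: p (m + 1))
    (hl : ∀ m, m ≤ (p m).length) :
    ∃ a : ℕ → α, ∀ m n, n ≤ (p m).length → (p m).take n = List.ofFn fun i : Fin n => a i := by
  have mono : ∀ m n, m ≤ n → p m <+: p n := by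
    intro m n h
    induction h with
    | refl => exact List.prefix_rfl
    | step _ ih => exact ih.trans (hp _)
  have get : ∀ m n i, i < (p m).length → i < (p n).length → (p m)[i]? = (p n)[i]? := by
    have aux : ∀ m n i, m ≤ n → i < (p m).length → (p m)[i]? = (p n)[i]? := by
      intro m n i h hi
      obtain ⟨t, ht⟩ := mono m n h
      rw [← ht, List.getElem?_append_left hi]
    intro m n i hm hn
    rcases le_total m n with h | h
    · exact aux m n i h hm
    · exact (aux n m i h hn).symm
  refine ⟨fun i => ((p (i+1))[i]?).getD default, fun m n hn => ?_⟩
  apply List.ext_getElem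
  · simp [hn]
  · intro i h1 h2
    have h3 : i < n := by simpa using h2
    have := get m (i+1) i (by omega) (hl (i+1))
    simp only [List.getElem_take, List.getElem_ofFn]
    rw [← this, List.getElem?_eq_getElem (by omega)]
    rfl

theorem lind_of_seq {X : Type*} [TopologicalSpace X] {𝓑 : Set (Set X)} (hne : 𝓑.Nonempty)
    {𝒰 : Set (Set X)} (C : ℕ → Set (Set X)) (hC : ∀ n, C n ⊆ 𝒰) (hf : ∀ n, (C n).Finite)
    (hcov : IsBCover 𝓑 (⋃ n, C n)) :
    ∃ U : ℕ → Set X, (∀ n, U n ∈ 𝒰) ∧ ∀ B ∈ 𝓑, ∃ n, B ⊆ U n := by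
  have hc : (⋃ n, C n).Countable := Set.countable_iUnion fun n => (hf n).countable
  obtain ⟨B₀, hB₀⟩ := hne
  obtain ⟨U₀, hU₀, -⟩ := hcov.2 B₀ hB₀
  obtain ⟨U, hU⟩ := hc.exists_eq_range ⟨U₀, hU₀⟩
  refine ⟨U, fun n => ?_, fun B hB => ?_⟩
  · have : U n ∈ ⋃ n, C n := hU ▸ Set.mem_range_self n
    obtain ⟨m, hm⟩ := Set.mem_iUnion.1 this
    exact hC m hm
  · obtain ⟨W, hW, hBW⟩ := hcov.2 B hB
    rw [hU] at hW
    obtain ⟨n, rfl⟩ := hW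
    exact ⟨n, hBW⟩

open Classical in
theorem I_one_to_M {X : Type*} [TopologicalSpace X] {𝓑 : Set (Set X)} (M : ℕ) (hM : 1 ≤ M)
    (τ : List (Set (Set X)) → Set (Set X)) (hτ : IWinning 𝓑 (fun _ => 2) τ) :
    ∃ τ, IWinning 𝓑 (fun _ => M + 1) τ := by
  have hne : 𝓑.Nonempty := by
    by_contra h
    rw [Set.not_nonempty_iff_eq_empty] at h
    subst h
    refine hτ.2 (fun _ => ∅) (fun n => by simp) ⟨by simp, by simp⟩
  by_cases L : LindB 𝓑
  swap
  · simp only [LindB, not_forall] at L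
    obtain ⟨𝒰, h𝒰, hno⟩ := L
    exact ⟨fun _ => 𝒰, fun _ => h𝒰, fun C hC hcov =>
      hno (lind_of_seq hne C (fun n => (hC n).1) (fun n => (hC n).2.1) hcov)⟩
  set τ' : List (Set X) → Set (Set X) := fun l => τ (l.map fun a => {a}) with hτ'
  choose 𝒱 h𝒱 hD using fun p : List (Set X) => key_lemma L M (fun l => τ' (p ++ l))
    (fun l => hτ.1 _)
  have hpick : ∀ (p : List (Set X)) (C : Set (Set X)), ∃ u : List (Set X),
      (C ⊆ 𝒱 p ∧ C.Finite ∧ C.ncard < M + 1) → u.length = M ∧ RunB (fun l => τ' (p ++ l)) u ∧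
        ∀ V ∈ C, ∃ W ∈ u, V ⊆ W := by
    intro p C
    by_cases h : C ⊆ 𝒱 p ∧ C.Finite ∧ C.ncard < M + 1
    · obtain ⟨h1, h2, h3⟩ := h
      obtain ⟨u, hu⟩ := hD p h2.toFinset (by simpa using h1) (by
        rw [← Set.ncard_eq_toFinset_card C h2]; omega)
      exact ⟨u, fun _ => by simpa using hu⟩
    · exact ⟨[], fun h' => absurd h' h⟩
  choose pick hp using hpick
  let pos : List (Set (Set X)) → List (Set X) := fun l => l.foldl (fun p C => p ++ pick p C) []
  refine ⟨fun l => 𝒱 (pos l), fun l => h𝒱 _, fun C hC hcov => ?_⟩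
  let p : ℕ → List (Set X) := fun n => pos (List.ofFn fun i : Fin n => C i)
  have hsucc : ∀ n, p (n+1) = p n ++ pick (p n) (C n) := by
    intro n
    simp only [p, pos]
    rw [List.ofFn_succ']
    simp
  have hstep := fun n => hp (p n) (C n) (hC n)
  have hrun : ∀ n, RunB τ' (p n) := by
    intro n
    induction n with
    | zero => simp [p, pos, RunB]
    | succ n ih => rw [hsucc]; exact RunB_append _ _ _ ih (hstep n).2.1
  have hlen : ∀ n, n ≤ (p n).length := by
    intro n
    induction n with
    | zero => simp
    | succ n ih => rw [hsucc, List.length_append, (hstep n).1]; omega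
  obtain ⟨a, ha⟩ := list_limit p (fun n => by rw [hsucc]; exact List.prefix_append _ _) hlen
  have hget : ∀ n i (h : i < (p n).length), (p n)[i] = a i := by
    intro n i h
    have := ha n (p n).length le_rfl
    rw [List.take_length] at this
    rw [List.getElem_of_eq this]; simp
  have hmem : ∀ n, a n ∈ τ (List.ofFn fun i : Fin n => {a i}) := by
    intro n
    have h := RunB_get _ _ (hrun (n+1)) n (hlen (n+1))
    rw [hget, ha (n+1) n ((Nat.le_succ n).trans (hlen (n+1)))] at h
    simp only [hτ', List.map_ofFn] at h
    exact h
  refine hτ.2 (fun n => {a n}) (fun n => ⟨by simpa using hmem n, by simp, by simp⟩) ⟨?_, ?_⟩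
  · intro U hU
    obtain ⟨n, hn⟩ := Set.mem_iUnion.1 hU
    rw [Set.mem_singleton_iff.1 hn]
    exact (hτ.1 _).1 _ (hmem n)
  · intro B hB
    obtain ⟨V, hV, hBV⟩ := hcov.2 B hB
    obtain ⟨n, hn⟩ := Set.mem_iUnion.1 hV
    obtain ⟨W, hW, hVW⟩ := (hstep n).2.2 V hn
    have hW' : W ∈ p (n+1) := by rw [hsucc]; simp [hW]
    obtain ⟨i, hi, rfl⟩ := List.getElem_of_mem hW'
    exact ⟨_, Set.mem_iUnion.2 ⟨i, by simp [hget]⟩, hBV.trans hVW⟩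

/-- II can force `P` in `k` further single selections. -/
def ForceB {X : Type*} [TopologicalSpace X] (𝓑 : Set (Set X)) (P : List (Set X) → Prop) :
    ℕ → List (Set X) → Prop
  | 0, u => P u
  | k + 1, u => ∀ 𝒰, IsBCover 𝓑 𝒰 → ∃ U ∈ 𝒰, ForceB 𝓑 P k (u ++ [U])

theorem not_force {X : Type*} [TopologicalSpace X] {𝓑 : Set (Set X)} {P : List (Set X) → Prop}
    (k : ℕ) : ∀ u, ¬ ForceB 𝓑 P k u → ∃ τ : List (Set X) → Set (Set X),
      (∀ l, IsBCover 𝓑 (τ l)) ∧ ∀ v, v.length = k → RunB τ v → ¬ P (u ++ v) := by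
  classical
  induction k with
  | zero =>
    intro u h
    refine ⟨fun _ => {Set.univ}, fun _ => ⟨by simp, by simp⟩, fun v hv _ => ?_⟩
    rw [List.length_eq_zero_iff] at hv
    simpa [hv, ForceB] using h
  | succ k ih =>
    intro u h
    simp only [ForceB] at h
    push Not at h
    obtain ⟨𝒰, h𝒰, hno⟩ := h
    have : ∀ U, ∃ τ : List (Set X) → Set (Set X),
      (∀ l, IsBCover 𝓑 (τ l)) ∧ (U ∈ 𝒰 → ∀ v, v.length = k → RunB τ v → ¬ P (u ++ [U] ++ v)) := by
      intro U
      by_cases hU : U ∈ 𝒰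
      · obtain ⟨τ, h1, h2⟩ := ih _ (hno U hU)
        exact ⟨τ, h1, fun _ => h2⟩
      · exact ⟨fun _ => 𝒰, fun _ => h𝒰, fun h => absurd h hU⟩
    choose τ h1 h2 using this
    refine ⟨fun l => match l with
      | [] => 𝒰
      | U :: l => τ U l, ?_, ?_⟩
    · intro l
      cases l with
      | nil => exact h𝒰
      | cons U l => exact h1 U l
    · intro v hv hr
      cases v with
      | nil => simp at hv
      | cons U v =>
        have := h2 U hr.1 v (by simpa using hv) hr.2
        simpa using this

/-- invariant of the simulation of the `M`-selection game by the single selection game -/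
structure InvB {X : Type*} [TopologicalSpace X] (𝓑 : Set (Set X)) (M : ℕ)
    (σ : List (Set (Set X)) → Set (Set X)) (s : List (Set (Set X))) (H : List (Set X))
    (j : ℕ) : Prop where
  cov : ∀ A ∈ s, IsBCover 𝓑 A
  ref : ∀ t A, t ++ [A] <+: s → ∀ V ∈ σ (t ++ [A]), ∃ W ∈ H, V ⊆ W
  force : ForceB 𝓑 (fun u => ∃ A, IsBCover 𝓑 A ∧ ∀ V ∈ σ (s ++ [A]), ∃ W ∈ u, V ⊆ W) j H
  pos : 1 ≤ j
  le : j ≤ M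
  len : H.length + j = (s.length + 1) * M

open Classical in
theorem II_M_to_one {X : Type*} [TopologicalSpace X] {𝓑 : Set (Set X)} (M : ℕ) (hM : 1 ≤ M)
    (σ : List (Set (Set X)) → Set (Set X)) (hσ : IIWinning 𝓑 (fun _ => M + 1) σ) :
    ∃ σ, IIWinning 𝓑 (fun _ => 2) σ := by
  by_cases hne : 𝓑.Nonempty
  swap
  · rw [Set.not_nonempty_iff_eq_empty] at hne
    subst hne
    exact ⟨fun _ => ∅, fun A _ => ⟨fun n => by simp, by simp, by simp⟩⟩
  have L : LindB 𝓑 := by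
    intro 𝒰 h𝒰
    have := hσ (fun _ => 𝒰) (fun _ => h𝒰)
    exact lind_of_seq hne _ (fun n => (this.1 n).1) (fun n => (this.1 n).2.1) this.2
  -- legality of responses at every position
  have legal : ∀ s : List (Set (Set X)), (∀ A ∈ s, IsBCover 𝓑 A) → ∀ A, IsBCover 𝓑 A →
      σ (s ++ [A]) ⊆ A ∧ (σ (s ++ [A])).Finite ∧ (σ (s ++ [A])).ncard < M + 1 := by
    intro s hs A hA
    have := (hσ (fun i => (s[i]?).getD A) (by
      intro i
      by_cases h : i < s.length
      · simp [h]; exact hs _ (List.getElem_mem h)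
      · simp [h]; exact hA)).1 s.length
    have e : (List.ofFn fun i : Fin (s.length + 1) => (s[(i : ℕ)]?).getD A) = s ++ [A] := by
      apply List.ext_getElem
      · simp
      · intro i h1 h2
        simp only [List.getElem_ofFn]
        by_cases h : i < s.length
        · simp [h]
        · have : i = s.length := by simp at h1; omega
          subst this; simp
    rw [e] at this
    simpa using this
  have force : ∀ s : List (Set (Set X)), (∀ A ∈ s, IsBCover 𝓑 A) → ∀ H,
      ForceB 𝓑 (fun u => ∃ A, IsBCover 𝓑 A ∧ ∀ V ∈ σ (s ++ [A]), ∃ W ∈ u, V ⊆ W) M H := by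
    intro s hs H
    by_contra hno
    obtain ⟨τ, hτ, hv⟩ := not_force M H hno
    obtain ⟨𝒱, h𝒱, hD⟩ := key_lemma L M τ hτ
    obtain ⟨h1, h2, h3⟩ := legal s hs 𝒱 h𝒱
    obtain ⟨u, hu, hr, href⟩ := hD h2.toFinset (by simpa using h1) (by
        rw [← Set.ncard_eq_toFinset_card _ h2]; omega)
    refine hv u hu hr ⟨𝒱, h𝒱, fun V hV => ?_⟩
    obtain ⟨W, hW, hVW⟩ := href V (by simpa using hV)
    exact ⟨W, by simp [hW], hVW⟩
  have step : ∀ (s : List (Set (Set X))) (H : List (Set X)) (j : ℕ) (𝒰 : Set (Set X)),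
      ∃ (s' : List (Set (Set X))) (U : Set X) (j' : ℕ), InvB 𝓑 M σ s H j → IsBCover 𝓑 𝒰 →
        U ∈ 𝒰 ∧ s <+: s' ∧ InvB 𝓑 M σ s' (H ++ [U]) j' := by
    intro s H j 𝒰
    by_cases h : InvB 𝓑 M σ s H j ∧ IsBCover 𝓑 𝒰
    swap
    · exact ⟨[], ∅, 0, fun h1 h2 => absurd ⟨h1, h2⟩ h⟩
    obtain ⟨hI, h𝒰⟩ := h
    obtain ⟨i, rfl⟩ : ∃ i, j = i + 1 := ⟨j - 1, by have := hI.pos; omega⟩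
    obtain ⟨U, hU, hF⟩ := hI.force 𝒰 h𝒰
    rcases Nat.eq_zero_or_pos i with rfl | hi
    · obtain ⟨A, hA, href⟩ := hF
      have hcov : ∀ A' ∈ s ++ [A], IsBCover 𝓑 A' := by
        intro A' hA'
        rcases List.mem_append.1 hA' with h | h
        · exact hI.cov _ h
        · rw [List.mem_singleton.1 h]; exact hA
      refine ⟨s ++ [A], U, M, fun _ _ => ⟨hU, List.prefix_append _ _, hcov, ?_, force _ hcov _,
        hM, le_rfl, ?_⟩⟩
      · intro t A' ht V hV
        rcases List.prefix_concat_iff.1 ht with h | h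
        · rw [h] at hV
          exact href V hV
        · obtain ⟨W, hW, hVW⟩ := hI.ref t A' h V hV
          exact ⟨W, by simp [hW], hVW⟩
      · have := hI.len
        simp only [List.length_append, List.length_singleton]
        rw [Nat.add_mul _ 1 M]
        omega
    · refine ⟨s, U, i, fun _ _ => ⟨hU, List.prefix_rfl, hI.cov, ?_, hF, hi, ?_, ?_⟩⟩
      · intro t A' h V hV
        obtain ⟨W, hW, hVW⟩ := hI.ref t A' h V hV
        exact ⟨W, by simp [hW], hVW⟩
      · have := hI.le; omega
      · have := hI.len
        simp only [List.length_append, List.length_singleton]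
        omega
  choose s' U j' hstep using step
  -- state : position, history of own selections, counter, last selection
  let St := List (Set (Set X)) × List (Set X) × ℕ × Set (Set X)
  let nxt : St → Set (Set X) → St := fun q 𝒰 =>
    (s' q.1 q.2.1 q.2.2.1 𝒰, q.2.1 ++ [U q.1 q.2.1 q.2.2.1 𝒰], j' q.1 q.2.1 q.2.2.1 𝒰,
      {U q.1 q.2.1 q.2.2.1 𝒰})
  let st : List (Set (Set X)) → St := fun l => l.foldl nxt ([], [], M, ∅)
  refine ⟨fun l => (st l).2.2.2, fun A hA => ?_⟩
  let S : ℕ → St := fun n => st (List.ofFn fun i : Fin n => A i)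
  have hS : ∀ n, S (n+1) = nxt (S n) (A n) := by
    intro n
    simp only [S, st]
    rw [List.ofFn_succ']
    simp
  have hinv : ∀ n, InvB 𝓑 M σ (S n).1 (S n).2.1 (S n).2.2.1 := by
    intro n
    induction n with
    | zero =>
      simp only [S, st, List.ofFn_zero, List.foldl_nil]
      exact ⟨by simp, by simp, force _ (by simp) _, hM, le_rfl, by simp⟩
    | succ n ih => rw [hS]; exact (hstep _ _ _ _ ih (hA n)).2.2
  have hst := fun n => hstep _ _ _ _ (hinv n) (hA n)
  have hlenH : ∀ n, (S n).2.1.length = n := by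
    intro n
    induction n with
    | zero => simp [S, st]
    | succ n ih => rw [hS]; simp [nxt, ih]
  have hmemH : ∀ n, ∀ W ∈ (S n).2.1, ∃ m, W ∈ (S (m+1)).2.2.2 := by
    intro n
    induction n with
    | zero => simp [S, st]
    | succ n ih =>
      intro W hW
      rw [hS] at hW
      rcases List.mem_append.1 hW with h | h
      · exact ih W h
      · refine ⟨n, ?_⟩
        rw [hS]
        simpa [nxt] using h
  have hpre : ∀ m d, (S m).1 <+: (S (m + d)).1 := by
    intro m d
    induction d with
    | zero => exact List.prefix_rfl
    | succ d ih =>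
      rw [← Nat.add_assoc, hS]
      exact ih.trans (hst _).2.1
  have hsel : ∀ n, (S (n+1)).2.2.2 ⊆ A n := by
    intro n
    rw [hS]
    simpa [nxt] using (hst n).1
  refine ⟨fun n => ⟨hsel n, ?_, ?_⟩, ?_, ?_⟩
  · change (S (n+1)).2.2.2.Finite
    rw [hS]; simp [nxt]
  · change (S (n+1)).2.2.2.ncard < 2
    rw [hS]; simp [nxt]
  · intro V hV
    obtain ⟨n, hn⟩ := Set.mem_iUnion.1 hV
    exact (hA n).1 _ (hsel n hn)
  · intro B hB
    have hlen : ∀ m, m ≤ (S (m * M)).1.length := by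
      intro m
      have h1 := (hinv (m * M)).len
      have h2 := (hinv (m * M)).pos
      rw [hlenH] at h1
      by_contra hlt
      have : ((S (m * M)).1.length + 1) * M ≤ m * M := Nat.mul_le_mul_right _ (by omega)
      omega
    obtain ⟨a, ha⟩ := list_limit (fun m => (S (m * M)).1)
      (fun m => by rw [Nat.add_mul, Nat.one_mul]; exact hpre _ _) hlen
    have htake := fun n => ha (n+1) (n+1) (hlen (n+1))
    have hcov : ∀ n, IsBCover 𝓑 (a n) := by
      intro n
      refine (hinv ((n+1) * M)).cov _ (List.mem_of_mem_take (i := n+1) ?_)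
      rw [htake n, List.mem_ofFn]
      exact ⟨⟨n, by omega⟩, rfl⟩
    obtain ⟨V, hV, hBV⟩ := (hσ a hcov).2.2 B hB
    obtain ⟨n, hn⟩ := Set.mem_iUnion.1 hV
    have hofn : (List.ofFn fun i : Fin (n+1) => a i) = (List.ofFn fun i : Fin n => a i) ++ [a n] := by
      rw [List.ofFn_succ']; simp
    obtain ⟨W, hW, hVW⟩ := (hinv ((n+1) * M)).ref (List.ofFn fun i : Fin n => a i) (a n) (by
      rw [← hofn, ← htake n]; exact List.take_prefix _ _) V (by rw [← hofn]; exact hn)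
    obtain ⟨m, hm⟩ := hmemH _ W hW
    exact ⟨W, Set.mem_iUnion.2 ⟨m, hm⟩, hBV.trans hVW⟩

theorem II_mono {X : Type*} [TopologicalSpace X] {𝓑 : Set (Set X)} {φ ψ : ℕ → ℕ}
    (h : ∀ n, φ n ≤ ψ n) (H : ∃ σ, IIWinning 𝓑 φ σ) : ∃ σ, IIWinning 𝓑 ψ σ := by
  obtain ⟨σ, hσ⟩ := H
  exact ⟨σ, fun A hA => ⟨fun n => ⟨((hσ A hA).1 n).1, ((hσ A hA).1 n).2.1,
    ((hσ A hA).1 n).2.2.trans_le (h n)⟩, (hσ A hA).2⟩⟩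

theorem I_mono {X : Type*} [TopologicalSpace X] {𝓑 : Set (Set X)} {φ ψ : ℕ → ℕ}
    (h : ∀ n, φ n ≤ ψ n) (H : ∃ σ, IWinning 𝓑 ψ σ) : ∃ σ, IWinning 𝓑 φ σ := by
  obtain ⟨σ, hσ⟩ := H
  exact ⟨σ, hσ.1, fun C hC => hσ.2 C fun n => ⟨(hC n).1, (hC n).2.1, (hC n).2.2.trans_le (h n)⟩⟩

/-- For a bounded `f : ω → [2, ℵ₀)` with `k = limsup f`, the games `G_f(O_𝓑, O_𝓑)` and
`G_k(O_𝓑, O_𝓑)` (where `G_k` uses the constant function `n ↦ k + 1`, i.e. selections of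
size `≤ k`) are equivalent: Player II has a winning strategy in one iff in the other,
and likewise for Player I. -/
theorem statement18 {X : Type*} [TopologicalSpace X] (𝓑 : Set (Set X))
    (f : ℕ → ℕ) (hf2 : ∀ n, 2 ≤ f n) (hbdd : ∃ M, ∀ n, f n ≤ M)
    (k : ℕ) (hk : k = Filter.limsup f Filter.atTop) :
    ((∃ σ, IIWinning 𝓑 f σ) ↔ ∃ σ, IIWinning 𝓑 (fun _ => k + 1) σ) ∧
    ((∃ τ, IWinning 𝓑 f τ) ↔ ∃ τ, IWinning 𝓑 (fun _ => k + 1) τ) := by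
  obtain ⟨M, hMf⟩ := hbdd
  have hM : 1 ≤ M := by have := hf2 0; have := hMf 0; omega
  have hk1 : 1 ≤ k := by
    have : 2 ≤ Filter.limsup f Filter.atTop :=
      Filter.le_limsup_of_frequently_le (Filter.Frequently.of_forall hf2)
        (Filter.isBoundedUnder_of ⟨M, hMf⟩)
    omega
  refine ⟨⟨fun h => ?_, fun ⟨σ, h⟩ => ?_⟩, ⟨fun h => ?_, fun h => ?_⟩⟩
  · obtain ⟨σ, hσ⟩ := II_mono (ψ := fun _ => M + 1) (fun n => (hMf n).trans (Nat.le_succ M)) h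
    exact II_mono (fun n => by omega) (II_M_to_one M hM σ hσ)
  · exact II_mono hf2 (II_M_to_one k hk1 σ h)
  · obtain ⟨τ, hτ⟩ := I_mono (φ := fun _ => 2) hf2 h
    exact I_one_to_M k hk1 τ hτ
  · obtain ⟨τ, hτ⟩ := I_mono (φ := fun _ => 2) (fun n => by omega) h
    exact I_mono (fun n => (hMf n).trans (Nat.le_succ M)) (I_one_to_M M hM τ hτ)
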